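/- For every reachable node n of a sound deterministic negotiation diagram 𝒩, the subnegotiation 𝒩|ₙ is sound: every run of 𝒩|ₙ from its initial configuration can be extended to a run reaching its final configuration. -/

import Mathlib

open scoped Classical
noncomputable section

/-- A deterministic negotiation diagram: processes `P`, nodes `N`, outcomes `R`. -/
structure DNeg (P N R : Type*) where
  dom : N → Set P
  out : N → Set R
  δ : N → R → P → Option N
  ninit : N
  nfin : N

namespace DNeg
variable {P N R : Type*}

/-- A node is enabled at a configuration if all its processes are at it. -/
def Enabled (G : DNeg P N R) (C : P → N) (n : N) : Prop := ∀ p ∈ G.dom n, C p = n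

/-- Executing an enabled location. -/
def Step (G : DNeg P N R) (C : P → N) (l : N × R) (C' : P → N) : Prop :=
  Enabled G C l.1 ∧ l.2 ∈ G.out l.1 ∧
    ∀ p, (p ∈ G.dom l.1 → G.δ l.1 l.2 p = some (C' p)) ∧ (p ∉ G.dom l.1 → C' p = C p)

/-- A run executes a sequence of locations. -/
inductive Run (G : DNeg P N R) : (P → N) → List (N × R) → (P → N) → Prop
  | nil (C) : Run G C [] C
  | cons {C C' C'' l w} : Step G C l C' → Run G C' w C'' → Run G C (l :: w) C''

def Cinit (G : DNeg P N R) : P → N := fun _ => G.ninit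
def Cfin (G : DNeg P N R) : P → N := fun _ => G.nfin

def Reachable (G : DNeg P N R) (C : P → N) : Prop := ∃ w, Run G (Cinit G) w C

def Successful (G : DNeg P N R) (w : List (N × R)) : Prop := Run G (Cinit G) w (Cfin G)

/-- Soundness: every initial run can be extended to a successful one. -/
def Sound (G : DNeg P N R) : Prop :=
  ∀ C w, Run G (Cinit G) w C → ∃ v, Run G C v (Cfin G)

/-- Independence of locations: disjoint domains of their nodes. -/
def Indep (G : DNeg P N R) (l1 l2 : N × R) : Prop := Disjoint (G.dom l1.1) (G.dom l2.1)

def Swap (G : DNeg P N R) (w1 w2 : List (N × R)) : Prop :=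
  ∃ u v l1 l2, Indep G l1 l2 ∧ w1 = u ++ l1 :: l2 :: v ∧ w2 = u ++ l2 :: l1 :: v

/-- Mazurkiewicz equivalence. -/
def MazEquiv (G : DNeg P N R) : List (N × R) → List (N × R) → Prop :=
  Relation.ReflTransGen (Swap G)

def ReachableNode (G : DNeg P N R) (m : N) : Prop :=
  ∃ C, Reachable G C ∧ Enabled G C m

/-- The graph of the negotiation diagram. -/
def Edge (G : DNeg P N R) (m m' : N) : Prop :=
  ∃ p a, a ∈ G.out m ∧ p ∈ G.dom m ∧ G.δ m a p = some m'

/-- A scheduler picks an enabled node after each initial run, whenever one exists. -/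
def IsScheduler (G : DNeg P N R) (S : List (N × R) → N) : Prop :=
  ∀ w C, Run G (Cinit G) w C → (∃ m, Enabled G C m) → Enabled G C (S w)

/-- A run is compatible with a scheduler. -/
def Compatible (G : DNeg P N R) (S : List (N × R) → N) (w : List (N × R)) : Prop :=
  ∀ i (h : i < w.length), 1 ≤ i → S (w.take i) = (w.get ⟨i, h⟩).1

/-- The transformer of a run: composition of the transformers of its locations. -/
def semRun {D : Type*} (sem : N × R → D → D) (w : List (N × R)) : D → D :=
  w.foldl (fun g l => sem l ∘ g) id

end DNeg

open DNeg

/-- The subnegotiation `𝒩|ₙ` induced by node `n` and the configuration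
`F = F(n)`: processes are `dom n`, the fresh final node is `none`, the initial
node is `n`, and transitions hitting `F p` are redirected to the final node. -/
def restrictNode {P N R : Type*} (G : DNeg P N R) (n : N) (F : P → N) :
    DNeg {p // p ∈ G.dom n} (Option N) R where
  dom := fun m? =>
    match m? with
    | some m => {p | (p : P) ∈ G.dom m}
    | none => Set.univ
  out := fun m? =>
    match m? with
    | some m => G.out m
    | none => ∅
  δ := fun m? a p =>
    match m? with
    | none => none
    | some m =>
      match G.δ m a (p : P) with
      | none => none
      | some m' => if m' = F (p : P) then some none else some (some m')
  ninit := some n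
  nfin := none

namespace DNeg
variable {P N R : Type*} {G : DNeg P N R}

theorem Run.append {C C' C'' : P → N} {v w : List (N × R)} (h : Run G C v C')
    (h' : Run G C' w C'') : Run G C (v ++ w) C'' := by
  induction h with
  | nil => exact h'
  | cons hs _ ih => exact .cons hs (ih h')

theorem Reachable.trans {C C' : P → N} {w : List (N × R)} (h : Reachable G C)
    (hw : Run G C w C') : Reachable G C' := by
  obtain ⟨u, hu⟩ := h
  exact ⟨u ++ w, hu.append hw⟩

theorem Run.eq_of_forall_notMem {C C' : P → N} {w : List (N × R)} (h : Run G C w C') {p : P}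
    (hp : ∀ l ∈ w, p ∉ G.dom l.1) : C' p = C p := by
  induction h with
  | nil => rfl
  | cons hs _ ih =>
    rw [ih fun l hl => hp l (by simp [hl])]
    exact (hs.2.2 p).2 (hp _ (by simp))

theorem Run.apply_mem_of_ne {C C' : P → N} {w : List (N × R)} (h : Run G C w C') {p : P}
    (hp : C' p ≠ C p) : ∃ l ∈ w, l.1 = C p ∧ p ∈ G.dom (C p) := by
  induction h with
  | nil => exact absurd rfl hp
  | @cons C C₁ _ l _ hs _ ih =>
    by_cases hpl : p ∈ G.dom l.1
    · have := hs.1 p hpl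
      exact ⟨l, by simp, this.symm, this ▸ hpl⟩
    · have h1 : C₁ p = C p := (hs.2.2 p).2 hpl
      rw [h1] at ih
      obtain ⟨l', hl', h⟩ := ih hp
      exact ⟨l', by simp [hl'], h⟩

/-- A process at a node shared with a process that is stuck elsewhere does not move. -/
theorem Run.eq_of_stuck {C C' : P → N} {w : List (N × R)} (h : Run G C w C') {p q : P}
    (hq : q ∉ G.dom (C q)) (hqp : q ∈ G.dom (C p)) : C' p = C p := by
  induction h with
  | nil => rfl
  | @cons C C₁ _ l _ hs _ ih =>
    have hql : q ∉ G.dom l.1 := fun h => hq ((hs.1 q h).symm ▸ h)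
    have hpl : p ∉ G.dom l.1 := fun h => hql (hs.1 p h ▸ hqp)
    have h1 : C₁ q = C q := (hs.2.2 q).2 hql
    have h2 : C₁ p = C p := (hs.2.2 p).2 hpl
    rw [h1, h2] at ih
    exact ih hq hqp

/-- In a sound negotiation, every reachable configuration other than the final one enables a
node other than the final node, even if the final node itself can be executed. -/
theorem Sound.exists_enabled_ne_nfin (hs : Sound G)
    {C : P → N} (hC : Reachable G C) (hCf : C ≠ Cfin G) :
    ∃ m, Enabled G C m ∧ m ≠ G.nfin := by
  by_contra! hno
  obtain ⟨w₀, hw₀⟩ := hC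
  obtain ⟨v, hv⟩ := hs C w₀ hw₀
  have hen : Enabled G C G.nfin := by
    cases hv with
    | nil => exact absurd rfl hCf
    | cons h _ => exact hno _ h.1 ▸ h.1
  have hfin : Reachable G (Cfin G) := ⟨_, hw₀.append hv⟩
  -- `X` replays from the final configuration the steps of the run on the processes of `nfin`.
  have key : ∀ (Z Y : P → N) (w : List (N × R)), Run G Z w Y → Y = Cfin G →
      (∀ p ∉ G.dom G.nfin, Z p = C p) → ∀ X, Reachable G X →
      (∀ p ∈ G.dom G.nfin, X p = Z p) → (∀ p ∉ G.dom G.nfin, X p = G.nfin) → False := by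
    intro Z Y w hw
    induction hw with
    | nil Z =>
      intro hY hZC _ _ _ _
      apply hCf
      funext p
      by_cases hp : p ∈ G.dom G.nfin
      · exact hen p hp
      · rw [← hZC p hp, hY]
    | @cons Z Z' Y l w hst hrun ih =>
      intro hY hZC X hX hXK hXn
      by_cases hsub : G.dom l.1 ⊆ G.dom G.nfin
      · let X' : P → N := fun p => if p ∈ G.dom l.1 then Z' p else X p
        have hstep : Step G X l X' := by
          refine ⟨fun p hp => by rw [hXK p (hsub hp)]; exact hst.1 p hp, hst.2.1, fun p => ?_⟩
          refine ⟨fun hp => ?_, fun hp => by simp [X', hp]⟩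
          simpa [X', hp] using (hst.2.2 p).1 hp
        refine ih hY (fun p hp => ?_) X' (hX.trans (.cons hstep (.nil _))) (fun p hp => ?_)
          (fun p hp => ?_)
        · rw [(hst.2.2 p).2 fun h => hp (hsub h), hZC p hp]
        · by_cases h : p ∈ G.dom l.1
          · simp [X', h]
          · simp [X', h, hXK p hp, (hst.2.2 p).2 h]
        · have h : p ∉ G.dom l.1 := fun h => hp (hsub h)
          simp [X', h, hXn p hp]
      · obtain ⟨q, hql, hq⟩ := Set.not_subset.1 hsub
        have hl : l.1 ≠ G.nfin := fun h => hq (h ▸ hql)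
        by_cases hdis : ∃ p ∈ G.dom l.1, p ∈ G.dom G.nfin
        · obtain ⟨p, hpl, hp⟩ := hdis
          have hXp : X p = l.1 := by rw [hXK p hp]; exact hst.1 p hpl
          obtain ⟨x, hx⟩ := hX
          obtain ⟨y, hy⟩ := hs X x hx
          have := hy.eq_of_stuck (p := p) (q := q) (by rw [hXn q hq]; exact hq)
            (by rw [hXp]; exact hql)
          exact hl (by rw [← hXp, ← this]; rfl)
        · push Not at hdis
          exact hl (hno l.1 fun p hp => by rw [← hZC p (hdis p hp)]; exact hst.1 p hp)
  exact key C _ v hv rfl (fun _ _ => rfl) (Cfin G) hfin (fun p hp => (hen p hp).symm)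
    (fun _ _ => rfl)

/-- A positional choice `σ` of outcomes on a finite set `S` of nodes along which every process
makes progress, measured by `ρ`, until it reaches the final node. -/
structure IsPlan (G : DNeg P N R) (S : Finset N) (σ : N → R) (ρ : N → ℕ) : Prop where
  nfin_notMem : G.nfin ∉ S
  mem_out : ∀ m ∈ S, σ m ∈ G.out m
  exists_next : ∀ m ∈ S, ∀ p ∈ G.dom m,
    ∃ m', G.δ m (σ m) p = some m' ∧ (m' = G.nfin ∨ m' ∈ S) ∧ ρ m < ρ m'

/-- Every process is at a node of `S` or at the final node. -/
def Covers (G : DNeg P N R) (S : Finset N) (C : P → N) : Prop := ∀ p, C p = G.nfin ∨ C p ∈ S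

/-- The locations of `w` are on nodes of `S` with the outcome chosen by `σ`. -/
def Follows (S : Finset N) (σ : N → R) (w : List (N × R)) : Prop :=
  ∀ l ∈ w, l.1 ∈ S ∧ l.2 = σ l.1

/-- The last outcome chosen at each node of a run to the final configuration gives a plan. -/
theorem Run.exists_isPlan {C C' : P → N} {w : List (N × R)} (h : Run G C w C')
    (hC' : C' = Cfin G) [Nonempty R] : ∃ S σ ρ, IsPlan G S σ ρ ∧ Covers G S C := by
  induction h with
  | nil =>
    subst hC'
    exact ⟨∅, fun _ => Classical.arbitrary R, fun _ => 0, ⟨by simp, by simp, by simp⟩,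
      fun p => .inl rfl⟩
  | @cons C C₁ _ l _ hs _ ih =>
    obtain ⟨S, σ, ρ, hpl, hcov⟩ := ih hC'
    by_cases hl : l.1 = G.nfin ∨ l.1 ∈ S
    · refine ⟨S, σ, ρ, hpl, fun p => ?_⟩
      by_cases hp : p ∈ G.dom l.1
      · rwa [hs.1 p hp]
      · rw [← (hs.2.2 p).2 hp]; exact hcov p
    · push Not at hl
      obtain ⟨hlf, hlS⟩ := hl
      have hne : ∀ {m}, (m = G.nfin ∨ m ∈ S) → m ≠ l.1 := by
        rintro m (hm | hm) h
        exacts [hlf (h.symm.trans hm), hlS (h ▸ hm)]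
      refine ⟨insert l.1 S, Function.update σ l.1 l.2,
        Function.update (fun m => ρ m + 1) l.1 0, ⟨?_, ?_, ?_⟩, fun p => ?_⟩
      · simp [hpl.nfin_notMem, hlf.symm]
      · intro m hm
        rcases Finset.mem_insert.1 hm with rfl | hm
        · simpa using hs.2.1
        · rw [Function.update_of_ne (hne (.inr hm))]
          exact hpl.mem_out m hm
      · intro m hm p hp
        rcases Finset.mem_insert.1 hm with rfl | hm
        · refine ⟨C₁ p, by simpa using (hs.2.2 p).1 hp, ?_, ?_⟩
          · exact (hcov p).imp_right Finset.mem_insert_of_mem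
          · simp [hne (hcov p)]
        · obtain ⟨m', h1, h2, h3⟩ := hpl.exists_next m hm p hp
          refine ⟨m', ?_, h2.imp_right Finset.mem_insert_of_mem, ?_⟩
          · rwa [Function.update_of_ne (hne (.inr hm))]
          · simpa [hne h2, hne (.inr hm)] using h3
      · by_cases hp : p ∈ G.dom l.1
        · right; rw [hs.1 p hp]; simp
        · rw [← (hs.2.2 p).2 hp]; exact (hcov p).imp_right Finset.mem_insert_of_mem

namespace IsPlan
variable {S : Finset N} {σ : N → R} {ρ : N → ℕ}

theorem exists_step (hpl : IsPlan G S σ ρ) {C : P → N} {m : N} (hm : m ∈ S)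
    (hen : Enabled G C m) : ∃ C', Step G C (m, σ m) C' := by
  have : Nonempty N := ⟨m⟩
  choose! f hf using hpl.exists_next m hm
  refine ⟨fun p => if p ∈ G.dom m then f p else C p, hen, hpl.mem_out m hm, fun p => ?_⟩
  refine ⟨fun hp => ?_, fun hp => if_neg hp⟩
  have hp' : p ∈ G.dom m := hp
  simpa [hp'] using (hf p hp).1

theorem step_next (hpl : IsPlan G S σ ρ) {C C' : P → N} {l : N × R} (hl : l.1 ∈ S)
    (hσ : l.2 = σ l.1) (hst : Step G C l C') {p : P} (hp : p ∈ G.dom l.1) :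
    (C' p = G.nfin ∨ C' p ∈ S) ∧ ρ l.1 < ρ (C' p) := by
  obtain ⟨m', h1, h2⟩ := hpl.exists_next _ hl p hp
  rw [← hσ, (hst.2.2 p).1 hp] at h1
  obtain rfl := Option.some.inj h1
  exact h2

theorem covers_of_run (hpl : IsPlan G S σ ρ) {C C' : P → N} {w : List (N × R)}
    (h : Run G C w C') (hw : Follows S σ w) (hC : Covers G S C) : Covers G S C' := by
  induction h with
  | nil => exact hC
  | @cons C C₁ _ l _ hst _ ih =>
    refine ih (fun l hl => hw l (by simp [hl])) fun p => ?_
    obtain ⟨h1, h2⟩ := hw l (by simp)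
    by_cases hp : p ∈ G.dom l.1
    · exact (hpl.step_next h1 h2 hst hp).1
    · rw [(hst.2.2 p).2 hp]; exact hC p

theorem rank_le (hpl : IsPlan G S σ ρ) {C C' : P → N} {w : List (N × R)}
    (h : Run G C w C') (hw : Follows S σ w) (p : P) : ρ (C p) ≤ ρ (C' p) := by
  induction h with
  | nil => rfl
  | @cons C C₁ _ l _ hst _ ih =>
    refine le_trans ?_ (ih fun l hl => hw l (by simp [hl]))
    obtain ⟨h1, h2⟩ := hw l (by simp)
    by_cases hp : p ∈ G.dom l.1
    · rw [hst.1 p hp]; exact (hpl.step_next h1 h2 hst hp).2.le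
    · rw [(hst.2.2 p).2 hp]

/-- A process only visits nodes of rank at least that of its initial node. -/
theorem eq_or_rank_lt (hpl : IsPlan G S σ ρ) {C C' : P → N} {w : List (N × R)}
    (h : Run G C w C') (hw : Follows S σ w) {m : N} (hm : m ∈ w.map Prod.fst) {p : P}
    (hp : p ∈ G.dom m) : C p ∈ S ∧ (C p = m ∨ ρ (C p) < ρ m) := by
  induction h with
  | nil => simp at hm
  | @cons C C₁ _ l _ hst _ ih =>
    obtain ⟨h1, h2⟩ := hw l (by simp)
    rw [List.map_cons, List.mem_cons] at hm
    by_cases hpl' : p ∈ G.dom l.1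
    · have hCp := hst.1 p hpl'
      refine ⟨hCp ▸ h1, ?_⟩
      rcases hm with rfl | hm
      · exact .inl hCp
      · right
        have h3 := (hpl.step_next h1 h2 hst hpl').2
        rw [hCp]
        rcases (ih (fun l hl => hw l (by simp [hl])) hm).2 with h | h
        · rwa [h] at h3
        · exact h3.trans h
    · rcases hm with rfl | hm
      · exact absurd hp hpl'
      · have := ih (fun l hl => hw l (by simp [hl])) hm
        rwa [(hst.2.2 p).2 hpl'] at this

theorem nodup (hpl : IsPlan G S σ ρ) (hdom : ∀ m, (G.dom m).Nonempty) {C C' : P → N}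
    {w : List (N × R)} (h : Run G C w C') (hw : Follows S σ w) : (w.map Prod.fst).Nodup := by
  induction h with
  | nil => simp
  | @cons C C₁ _ l w hst hrun ih =>
    have hw' : Follows S σ w := fun l hl => hw l (by simp [hl])
    rw [List.map_cons, List.nodup_cons]
    refine ⟨fun hmem => ?_, ih hw'⟩
    obtain ⟨p, hp⟩ := hdom l.1
    obtain ⟨h1, h2⟩ := hw l (by simp)
    have h3 := (hpl.step_next h1 h2 hst hp).2
    rcases (hpl.eq_or_rank_lt hrun hw' hmem hp).2 with h | h
    · rw [h] at h3; exact lt_irrefl _ h3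
    · exact lt_asymm h h3

/-- Following a plan on the nodes satisfying `E` terminates. -/
theorem exists_maximal_run (hpl : IsPlan G S σ ρ) (hdom : ∀ m, (G.dom m).Nonempty)
    (E : N → Prop) (C : P → N) : ∃ w Z, Run G C w Z ∧ Follows S σ w ∧ (∀ l ∈ w, E l.1) ∧
      ∀ m ∈ S, E m → ¬ Enabled G Z m := by
  by_contra hcon
  have key : ∀ (k : ℕ) (C : P → N),
      (∃ w Z, Run G C w Z ∧ Follows S σ w ∧ (∀ l ∈ w, E l.1) ∧
        ∀ m ∈ S, E m → ¬ Enabled G Z m) ∨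
      ∃ w Z, Run G C w Z ∧ Follows S σ w ∧ w.length = k := by
    intro k
    induction k with
    | zero => exact fun C => .inr ⟨[], C, .nil C, by simp [Follows], rfl⟩
    | succ k ih =>
      intro C
      by_cases hst : ∀ m ∈ S, E m → ¬ Enabled G C m
      · exact .inl ⟨[], C, .nil C, by simp [Follows], by simp, hst⟩
      · push Not at hst
        obtain ⟨m, hm, hE, hen⟩ := hst
        obtain ⟨C', hC'⟩ := hpl.exists_step hm hen
        have hcons : ∀ {w}, Follows S σ w → Follows S σ ((m, σ m) :: w) := fun hw l hl => by
          rcases List.mem_cons.1 hl with rfl | hl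
          exacts [⟨hm, rfl⟩, hw l hl]
        rcases ih C' with ⟨w, Z, h1, h2, h3, h4⟩ | ⟨w, Z, h1, h2, h3⟩
        · refine .inl ⟨_, Z, .cons hC' h1, hcons h2, fun l hl => ?_, h4⟩
          rcases List.mem_cons.1 hl with rfl | hl
          exacts [hE, h3 l hl]
        · exact .inr ⟨_, Z, .cons hC' h1, hcons h2, by simp [h3]⟩
  obtain ⟨w, Z, h1, h2, h3⟩ := (key (S.card + 1) C).resolve_left hcon
  have hsub : (w.map Prod.fst).toFinset ⊆ S := fun m hm => by
    obtain ⟨l, hl, rfl⟩ := List.mem_map.1 (List.mem_toFinset.1 hm)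
    exact (h2 l hl).1
  have := Finset.card_le_card hsub
  rw [List.toFinset_card_of_nodup (hpl.nodup hdom h1 h2), List.length_map, h3] at this
  omega

/-- Following a plan reaches the final configuration as soon as all enabled nodes are in it. -/
theorem exists_run_fin (hpl : IsPlan G S σ ρ) (hs : Sound G) (hdom : ∀ m, (G.dom m).Nonempty)
    {C : P → N} (hC : Reachable G C) (hQ : ∀ m, Enabled G C m → m ≠ G.nfin → m ∈ S) :
    ∃ w, Run G C w (Cfin G) ∧ Follows S σ w := by
  obtain ⟨w, Z, h1, h2, -, h4⟩ := hpl.exists_maximal_run hdom (fun _ => True) C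
  have hQZ : ∀ m, Enabled G Z m → m ≠ G.nfin → m ∈ S := by
    clear h4 hC
    induction h1 with
    | nil => exact hQ
    | @cons C C₁ _ l _ hst _ ih =>
      refine ih (fun m hm hmf => ?_) fun l hl => h2 l (by simp [hl])
      obtain ⟨h3, h4⟩ := h2 l (by simp)
      by_cases hdis : ∃ p ∈ G.dom m, p ∈ G.dom l.1
      · obtain ⟨p, hp, hpl'⟩ := hdis
        have := (hpl.step_next h3 h4 hst hpl').1
        rw [hm p hp] at this
        exact this.resolve_left hmf
      · push Not at hdis
        exact hQ m (fun p hp => by rw [← (hst.2.2 p).2 (hdis p hp)]; exact hm p hp) hmf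
  have hZ : Z = Cfin G := by
    by_contra hne
    obtain ⟨m, hm, hmf⟩ := hs.exists_enabled_ne_nfin (hC.trans h1) hne
    exact h4 m (hQZ m hm hmf) trivial hm
  exact ⟨w, hZ ▸ h1, h2⟩

theorem mem_of_run_fin {C : P → N} {w : List (N × R)} (h : Run G C w (Cfin G)) {p : P}
    (hp : C p ≠ G.nfin) : C p ∈ w.map Prod.fst ∧ p ∈ G.dom (C p) := by
  obtain ⟨l, hl, h1, h2⟩ := h.apply_mem_of_ne (p := p) hp.symm
  exact ⟨List.mem_map.2 ⟨l, hl, h1⟩, h2⟩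

theorem next_mem_of_run_fin {C Y : P → N} {w : List (N × R)} (h : Run G C w Y)
    (hY : Y = Cfin G) (hw : Follows S σ w) {m m' : N} (hm : m ∈ w.map Prod.fst) {p : P}
    (hp : p ∈ G.dom m) (hδ : G.δ m (σ m) p = some m') (hm' : m' ≠ G.nfin) :
    m' ∈ w.map Prod.fst := by
  induction h with
  | nil => simp at hm
  | @cons C C₁ _ l w hst hrun ih =>
    rw [List.map_cons, List.mem_cons] at hm ⊢
    right
    rcases hm with rfl | hm
    · rw [← (hw l (by simp)).2, (hst.2.2 p).1 hp] at hδ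
      obtain rfl := Option.some.inj hδ
      exact (mem_of_run_fin (hY ▸ hrun) hm').1
    · exact ih hY (fun l hl => hw l (by simp [hl])) hm

/-- The nodes of `w₂` occur in `w₁` as soon as its initially enabled ones do. -/
theorem subset_of_enabled {C₁ C₂ Z : P → N} {w₁ w₂ : List (N × R)}
    (hpl : IsPlan G S σ ρ) (h₁ : Run G C₁ w₁ (Cfin G)) (hw₁ : Follows S σ w₁)
    (h₂ : Run G C₂ w₂ Z) (hw₂ : Follows S σ w₂)
    (hen : ∀ m ∈ S, Enabled G C₂ m → m ∈ w₁.map Prod.fst) :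
    ∀ l ∈ w₂, l.1 ∈ w₁.map Prod.fst := by
  induction h₂ with
  | nil => simp
  | @cons C C' _ l w hst hrun ih =>
    obtain ⟨h3, h4⟩ := hw₂ l (by simp)
    have hl := hen l.1 h3 hst.1
    have hrest := ih (fun l hl => hw₂ l (by simp [hl])) fun m hm hmen => by
      by_cases hdis : ∃ p ∈ G.dom m, p ∈ G.dom l.1
      · obtain ⟨p, hp, hpl'⟩ := hdis
        refine next_mem_of_run_fin h₁ rfl hw₁ hl hpl' (m' := m) ?_ ?_
        · rw [← h4, (hst.2.2 p).1 hpl', hmen p hp]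
        · rintro rfl; exact hpl.nfin_notMem hm
      · push Not at hdis
        exact hen m hm fun p hp => by rw [← (hst.2.2 p).2 (hdis p hp)]; exact hmen p hp
    intro l' hl'
    rcases List.mem_cons.1 hl' with rfl | hl'
    exacts [hl, hrest l' hl']

/-- Reachable configurations that agree outside `D` and enable no node with domain in `D` are
equal. -/
theorem eq_of_stuck (hpl : IsPlan G S σ ρ) (hs : Sound G) (hdom : ∀ m, (G.dom m).Nonempty)
    {D : Set P} {C₁ C₂ : P → N} (h₁ : Reachable G C₁) (h₂ : Reachable G C₂)
    (hcov : Covers G S C₂) (hst₁ : ∀ m, Enabled G C₁ m → ¬ G.dom m ⊆ D)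
    (hst₂ : ∀ m ∈ S, G.dom m ⊆ D → ¬ Enabled G C₂ m) (hD : ∀ p ∉ D, C₁ p = C₂ p) :
    C₁ = C₂ := by
  obtain ⟨w₂, hr₂, hw₂⟩ := hpl.exists_run_fin hs hdom h₂ fun m hm hmf => by
    obtain ⟨p, hp⟩ := hdom m
    have := hcov p
    rw [hm p hp] at this
    exact this.resolve_left hmf
  obtain ⟨w₁, hr₁, hw₁⟩ := hpl.exists_run_fin hs hdom h₁ fun m hm hmf => by
    obtain ⟨p, hp, hpD⟩ := Set.not_subset.1 (hst₁ m hm)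
    have := hcov p
    rw [← hD p hpD, hm p hp] at this
    exact this.resolve_left hmf
  have h₂₁ := hpl.subset_of_enabled hr₁ hw₁ hr₂ hw₂ fun m hm hen => by
    obtain ⟨p, hp, hpD⟩ := Set.not_subset.1 fun h => hst₂ m hm h hen
    have hCp : C₁ p = m := by rw [hD p hpD, hen p hp]
    rw [← hCp]
    exact (mem_of_run_fin hr₁ fun h => hpl.nfin_notMem (by rwa [← h, hCp])).1
  have h₁₂ := hpl.subset_of_enabled hr₂ hw₂ hr₁ hw₁ fun m hm hen => by
    obtain ⟨p, hp, hpD⟩ := Set.not_subset.1 (hst₁ m hen)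
    have hCp : C₂ p = m := by rw [← hD p hpD, hen p hp]
    rw [← hCp]
    exact (mem_of_run_fin hr₂ fun h => hpl.nfin_notMem (by rwa [← h, hCp])).1
  have hcmp : ∀ {A B : P → N} {u v : List (N × R)}, Run G A u (Cfin G) → Run G B v (Cfin G) →
      Follows S σ v → (∀ l ∈ u, l.1 ∈ v.map Prod.fst) → ∀ p, A p ≠ G.nfin →
      B p ∈ S ∧ (B p = A p ∨ ρ (B p) < ρ (A p)) := by
    intro A B u v hu hv hfv huv p hp
    obtain ⟨hm, hpd⟩ := mem_of_run_fin hu hp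
    obtain ⟨l, hl, hlA⟩ := List.mem_map.1 hm
    exact hpl.eq_or_rank_lt hv hfv (hlA ▸ huv l hl) hpd
  funext p
  by_contra hne
  have ha := hcmp hr₁ hr₂ hw₂ h₁₂ p
  have hb := hcmp hr₂ hr₁ hw₁ h₂₁ p
  by_cases hf : C₁ p = G.nfin
  · exact hpl.nfin_notMem (hf ▸ (hb fun h => hne (hf.trans h.symm)).1)
  · obtain ⟨hm, h | h⟩ := ha hf
    · exact hne h.symm
    · rcases (hb fun h => hpl.nfin_notMem (h ▸ hm)).2 with h' | h'
      · exact hne h'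
      · exact lt_asymm h h'

end IsPlan

/-- Every configuration reachable from `I` by a run inside `D` reaches `F` along a plan. -/
theorem Sound.exists_plan_run (hs : Sound G) (hdom : ∀ m, (G.dom m).Nonempty) [Nonempty R]
    {D : Set P} {C F : P → N} (hC : Reachable G C) (hF : Reachable G F)
    (hstuck : ∀ m, Enabled G F m → ¬ G.dom m ⊆ D) (hCF : ∀ p ∉ D, F p = C p) :
    ∃ S σ ρ w, IsPlan G S σ ρ ∧ Run G C w F ∧ Follows S σ w ∧ ∀ l ∈ w, G.dom l.1 ⊆ D := by
  obtain ⟨x, hx⟩ := hC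
  obtain ⟨v, hv⟩ := hs C x hx
  obtain ⟨S, σ, ρ, hpl, hcov⟩ := hv.exists_isPlan rfl
  obtain ⟨w, Z, h1, h2, h3, h4⟩ := hpl.exists_maximal_run hdom (fun m => G.dom m ⊆ D) C
  have hFZ : F = Z := hpl.eq_of_stuck hs hdom hF (Reachable.trans ⟨x, hx⟩ h1)
    (hpl.covers_of_run h1 h2 hcov) hstuck h4 fun p hp => by
      rw [hCF p hp, h1.eq_of_forall_notMem fun l hl h => hp (h3 l hl h)]
  exact ⟨S, σ, ρ, w, hpl, hFZ ▸ h1, h2, h3⟩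

/-- The configuration of `restrictNode G n F` corresponding to `C`. -/
def restrictConf (G : DNeg P N R) (n : N) (F C : P → N) : {p // p ∈ G.dom n} → Option N :=
  fun p => if C p = F p then none else some (C p)

theorem restrictConf_self (n : N) (F : P → N) :
    restrictConf G n F F = Cfin (restrictNode G n F) := by
  funext p; simp [restrictConf, Cfin, restrictNode]

theorem restrictNode_δ (n : N) (F C : P → N) {m : N} {a : R} (p : {p // p ∈ G.dom n})
    (h : G.δ m a p = some (C p)) :
    (restrictNode G n F).δ (some m) a p = some (restrictConf G n F C p) := by
  simp only [restrictNode, restrictConf, h]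
  split_ifs <;> rfl

/-- A run inside `dom n` along a plan to `F` is a run of the restriction. -/
theorem IsPlan.exists_restrict_run {S : Finset N} {σ : N → R} {ρ : N → ℕ}
    (hpl : IsPlan G S σ ρ) {n : N} {C F : P → N} {w : List (N × R)} (h : Run G C w F)
    (hw : Follows S σ w) : ∃ v, Run (restrictNode G n F) (restrictConf G n F C) v
      (restrictConf G n F F) := by
  induction h with
  | nil => exact ⟨[], .nil _⟩
  | @cons C C' F l w hst hrun ih =>
    have hw' : Follows S σ w := fun l hl => hw l (by simp [hl])
    obtain ⟨h1, h2⟩ := hw l (by simp)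
    obtain ⟨v, hv⟩ := ih hw'
    refine ⟨(some l.1, l.2) :: v, .cons ⟨fun p hp => ?_, hst.2.1, fun p => ⟨fun hp => ?_, ?_⟩⟩ hv⟩
    · have hCp := hst.1 p hp
      have hne : l.1 ≠ F p := fun h => by
        have := (hpl.step_next h1 h2 hst hp).2.trans_le (hpl.rank_le hrun hw' p)
        rw [h] at this
        exact lt_irrefl _ this
      simp [restrictConf, hCp, hne]
    · exact restrictNode_δ n F C' p ((hst.2.2 p).1 hp)
    · intro hp
      have : C' p = C p := (hst.2.2 p).2 hp
      simp [restrictConf, this]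

/-- A step of the restriction is a step of the negotiation inside `dom n`, or does nothing. -/
theorem Step.of_restrict {n : N} {F C : P → N} {l : Option N × R}
    {X : {p // p ∈ G.dom n} → Option N} (hst : Step (restrictNode G n F) (restrictConf G n F C) l X)
    (hmove : ∀ p, C p ≠ F p → G.dom (C p) ⊆ G.dom n) :
    X = restrictConf G n F C ∨ ∃ m C', G.dom m ⊆ G.dom n ∧ Step G C (m, l.2) C' ∧
      X = restrictConf G n F C' := by
  obtain ⟨_ | m, a⟩ := l
  · exact absurd hst.2.1 (by simp [restrictNode])
  obtain ⟨hen, hout, hδ⟩ := hst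
  by_cases hdis : ∃ p ∈ G.dom m, p ∈ G.dom n
  · right
    have hat : ∀ p, p ∈ G.dom m → p ∈ G.dom n → C p = m ∧ m ≠ F p := fun p hp hpn => by
      have := hen ⟨p, hpn⟩ hp
      simp only [restrictConf] at this
      split_ifs at this with h
      obtain rfl := Option.some.inj this
      exact ⟨rfl, h⟩
    obtain ⟨p, hp, hpn⟩ := hdis
    obtain ⟨h1, h2⟩ := hat p hp hpn
    have hsub : G.dom m ⊆ G.dom n := h1 ▸ hmove p (h1 ▸ h2)
    have hnext : ∀ p ∈ G.dom m, ∃ m', G.δ m a p = some m' := fun p hp => by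
      have := (hδ ⟨p, hsub hp⟩).1 hp
      simp only [restrictNode] at this
      split at this
      · cases this
      · exact ⟨_, by assumption⟩
    have : Nonempty N := ⟨m⟩
    choose! f hf using hnext
    let C' : P → N := fun p => if p ∈ G.dom m then f p else C p
    refine ⟨m, C', hsub, ⟨fun p hp => (hat p hp (hsub hp)).1, hout, fun p => ⟨fun hp => ?_,
      fun hp => if_neg hp⟩⟩, funext fun p => ?_⟩
    · have hp' : p ∈ G.dom m := hp
      simpa [C', hp'] using hf p hp
    · by_cases hp : (p : P) ∈ G.dom m
      · refine Option.some.inj (((hδ p).1 hp).symm.trans (restrictNode_δ n F C' p ?_))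
        simpa [C', hp] using hf p hp
      · rw [(hδ p).2 hp]
        simp [restrictConf, C', hp]
  · left
    funext p
    exact (hδ p).2 fun hp => hdis ⟨p, hp, p.2⟩

end DNeg

/-- the subnegotiation `𝒩|ₙ` of a sound deterministic
negotiation diagram is sound. -/
theorem restriction_sound {P N R : Type*} (G : DNeg P N R)
    (hs : Sound G) (n : N) (hn : ReachableNode G n) (I F : P → N)
    (hI : Reachable G I ∧ Enabled G I n ∧ ∀ m', Enabled G I m' → m' = n)
    (hF : (∃ u, (∀ l ∈ u, G.dom l.1 ⊆ G.dom n) ∧ Run G I u F) ∧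
      ∀ m', Enabled G F m' → ¬ G.dom m' ⊆ G.dom n) :
    Sound (restrictNode G n F) := by
  obtain ⟨hIr, hIn, hIu⟩ := hI
  obtain ⟨⟨u, hu, huF⟩, hstuck⟩ := hF
  have hdom : ∀ m, (G.dom m).Nonempty := fun m => by
    by_contra hm
    rw [Set.not_nonempty_iff_eq_empty] at hm
    obtain rfl := hIu m fun p hp => by simp [hm] at hp
    exact hstuck m (fun p hp => by simp [hm] at hp) subset_rfl
  have hIF : I ≠ F := by
    rintro rfl
    exact hstuck n hIn subset_rfl
  have : Nonempty R := by
    cases huF with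
    | nil => exact absurd rfl hIF
    | @cons _ _ _ l => exact ⟨l.2⟩
  have hout : ∀ p ∉ G.dom n, F p = I p := fun p hp =>
    huF.eq_of_forall_notMem fun l hl h => hp (hu l hl h)
  have hFr := hIr.trans huF
  have hinit : restrictConf G n F I = Cinit (restrictNode G n F) := by
    obtain ⟨S, σ, ρ, w, hpl, hw, hfw, -⟩ := hs.exists_plan_run hdom hIr hFr hstuck hout
    funext p
    have hIp : I p = n := hIn p p.2
    have hne : I p ≠ F p := by
      cases hw with
      | nil => exact absurd rfl hIF
      | @cons _ C _ l w hst hrun =>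
        obtain ⟨h1, h2⟩ := hfw l (by simp)
        have hl := hIu _ hst.1
        have hlt := (hpl.step_next h1 h2 hst (p := p) (by rw [hl]; exact p.2)).2.trans_le
          (hpl.rank_le hrun (fun l hl => hfw l (by simp [hl])) p)
        intro h
        rw [← h, hIp, hl] at hlt
        exact lt_irrefl _ hlt
    simp only [restrictConf, if_neg hne]
    rw [hIp]
    rfl
  have key : ∀ (X Y : {p // p ∈ G.dom n} → Option N) (w : List (Option N × R)),
      Run (restrictNode G n F) X w Y → ∀ C, Reachable G C → (∀ p ∉ G.dom n, F p = C p) →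
      X = restrictConf G n F C → ∃ v, Run (restrictNode G n F) Y v
        (Cfin (restrictNode G n F)) := by
    intro X Y w hw
    induction hw with
    | nil X =>
      rintro C hC hCF rfl
      obtain ⟨S, σ, ρ, w, hpl, hw, hfw, -⟩ := hs.exists_plan_run hdom hC hFr hstuck hCF
      obtain ⟨v, hv⟩ := hpl.exists_restrict_run (n := n) hw hfw
      exact ⟨v, restrictConf_self (G := G) n F ▸ hv⟩
    | @cons X X' Y l w hst hrun ih =>
      rintro C hC hCF rfl
      have hmove : ∀ p, C p ≠ F p → G.dom (C p) ⊆ G.dom n := fun p hp => by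
        obtain ⟨S, σ, ρ, w, -, hw, -, hwn⟩ := hs.exists_plan_run hdom hC hFr hstuck hCF
        obtain ⟨l, hl, hlC, -⟩ := hw.apply_mem_of_ne hp.symm
        exact hlC ▸ hwn l hl
      rcases hst.of_restrict hmove with rfl | ⟨m, C', hm, hst', rfl⟩
      · exact ih C hC hCF rfl
      · refine ih C' (hC.trans (.cons hst' (.nil _))) (fun p hp => ?_) rfl
        rw [hCF p hp, (hst'.2.2 p).2 fun h => hp (hm h)]
  intro C w hw
  exact key _ _ _ hw I hIr hout hinit.symm
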